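/- Let β and t be real numbers with t > 0. Then ∑_{n=0}^{∞} (β²/(1+β²))ⁿ · γ(n+1/2, (1+β²)t) / Γ(n+1/2) = (1+β²)·erf(√((1+β²)t)) − e^{−t}·β·√(1+β²)·erf(β√t). -/

import Mathlib

/-- The lower incomplete gamma function `γ(x, y) = ∫_0^y t^(x-1) e^(-t) dt`. -/
noncomputable def lowerGamma (x y : ℝ) : ℝ :=
  ∫ t in (0 : ℝ)..y, t ^ (x - 1) * Real.exp (-t)

/-- The error function `erf(x) = (2/√π) ∫_0^x e^(-t²) dt`. -/
noncomputable def erf (x : ℝ) : ℝ :=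
  (2 / Real.sqrt Real.pi) * ∫ t in (0 : ℝ)..x, Real.exp (-t ^ 2)

lemma lg_int (s x : ℝ) (hs : 0 < s) :
    IntervalIntegrable (fun t : ℝ => t ^ (s - 1) * Real.exp (-t)) MeasureTheory.volume 0 x := by
  apply IntervalIntegrable.mul_continuousOn
  · exact intervalIntegral.intervalIntegrable_rpow' (by linarith)
  · fun_prop

lemma lg_rec (s x : ℝ) (hs : 0 < s) (hx : 0 ≤ x) :
    lowerGamma (s + 1) x = s * lowerGamma s x - x ^ s * Real.exp (-x) := by
  have h1 := lg_int s x hs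
  have h2 := lg_int (s + 1) x (by linarith)
  have key : ∫ t in (0 : ℝ)..x, (s * (t ^ (s - 1) * Real.exp (-t)) -
      t ^ (s + 1 - 1) * Real.exp (-t)) = x ^ s * Real.exp (-x) - 0 ^ s * Real.exp (-0) := by
    apply intervalIntegral.integral_eq_sub_of_hasDerivAt_of_le hx
      (f := fun t : ℝ => t ^ s * Real.exp (-t))
    · apply ContinuousOn.mul
      · exact (Real.continuous_rpow_const hs.le).continuousOn
      · fun_prop
    · intro t ht
      have := (Real.hasDerivAt_rpow_const (x := t) (p := s) (Or.inl ht.1.ne')).mul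
        ((hasDerivAt_id t).neg.exp)
      refine this.congr_deriv ?_
      simp only [Pi.neg_apply, id, add_sub_cancel_right]
      ring
    · exact (h1.const_mul s).sub h2
  rw [intervalIntegral.integral_sub (h1.const_mul s) h2, intervalIntegral.integral_const_mul,
    Real.zero_rpow hs.ne'] at key
  unfold lowerGamma
  linarith

lemma lg_half (x : ℝ) (hx : 0 ≤ x) :
    lowerGamma (1 / 2) x = Real.sqrt Real.pi * erf (Real.sqrt x) := by
  have hc : Continuous (fun t : ℝ => Real.exp (-t ^ 2)) := by fun_prop
  have hd : ∀ u : ℝ, HasDerivAt (fun u : ℝ => ∫ t in (0 : ℝ)..u, Real.exp (-t ^ 2))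
      (Real.exp (-u ^ 2)) u := fun u =>
    intervalIntegral.integral_hasDerivAt_right (hc.intervalIntegrable _ _)
      hc.stronglyMeasurable.stronglyMeasurableAtFilter hc.continuousAt
  have key : ∫ t in (0 : ℝ)..x, t ^ ((1 / 2 : ℝ) - 1) * Real.exp (-t) =
      2 * (∫ t in (0 : ℝ)..(Real.sqrt x), Real.exp (-t ^ 2)) -
      2 * (∫ t in (0 : ℝ)..(Real.sqrt 0), Real.exp (-t ^ 2)) := by
    apply intervalIntegral.integral_eq_sub_of_hasDerivAt_of_le hx
      (f := fun u : ℝ => 2 * (∫ t in (0 : ℝ)..(Real.sqrt u), Real.exp (-t ^ 2)))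
    · have : Continuous (fun u : ℝ => ∫ t in (0 : ℝ)..u, Real.exp (-t ^ 2)) :=
        continuous_iff_continuousAt.2 fun u => (hd u).continuousAt
      exact (continuous_const.mul (this.comp Real.continuous_sqrt)).continuousOn
    · intro t ht
      have := ((hd (Real.sqrt t)).comp t (Real.hasDerivAt_sqrt ht.1.ne')).const_mul 2
      refine this.congr_deriv ?_
      rw [Real.sq_sqrt ht.1.le, show (1 / 2 : ℝ) - 1 = - (1 / 2) by norm_num,
        Real.rpow_neg ht.1.le, ← Real.sqrt_eq_rpow]
      have := Real.sqrt_pos.2 ht.1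
      field_simp
    · exact lg_int _ x (by norm_num)
  unfold lowerGamma erf
  rw [key]
  have := Real.sqrt_pos.2 Real.pi_pos
  simp
  field_simp

lemma lg_nonneg (s x : ℝ) (hx : 0 ≤ x) : 0 ≤ lowerGamma s x := by
  apply intervalIntegral.integral_nonneg hx
  intro t ht
  have := Real.rpow_nonneg ht.1 (s - 1)
  positivity

lemma lg_le (s x : ℝ) (hs : 0 < s) (hx : 0 ≤ x) : lowerGamma s x ≤ x ^ s / s := by
  have : x ^ s / s = ∫ t in (0 : ℝ)..x, t ^ (s - 1) := by
    rw [integral_rpow (Or.inl (by linarith))]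
    simp [Real.zero_rpow hs.ne']
  rw [this]
  apply intervalIntegral.integral_mono_on hx (lg_int s x hs)
    (intervalIntegral.intervalIntegrable_rpow' (by linarith))
  intro t ht
  have h := Real.rpow_nonneg ht.1 (s - 1)
  have : Real.exp (-t) ≤ 1 := Real.exp_le_one_iff.2 (by linarith [ht.1])
  nlinarith

noncomputable def aa (x : ℝ) (n : ℕ) : ℝ :=
  lowerGamma ((n : ℝ) + 1 / 2) x / Real.Gamma ((n : ℝ) + 1 / 2)

noncomputable def bb (x : ℝ) (n : ℕ) : ℝ :=
  x ^ n * Real.sqrt x * Real.exp (-x) / Real.Gamma ((n : ℝ) + 3 / 2)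

lemma gam_rec (n : ℕ) : Real.Gamma ((n : ℝ) + 3 / 2) =
    ((n : ℝ) + 1 / 2) * Real.Gamma ((n : ℝ) + 1 / 2) := by
  rw [← Real.Gamma_add_one (by positivity)]
  congr 1
  ring

lemma rp (x : ℝ) (hx : 0 ≤ x) (n : ℕ) : x ^ ((n : ℝ) + 1 / 2) = x ^ n * Real.sqrt x := by
  rw [Real.rpow_add_of_nonneg hx (by positivity) (by norm_num), Real.rpow_natCast,
    Real.sqrt_eq_rpow]

lemma aa_succ (x : ℝ) (hx : 0 ≤ x) (n : ℕ) : aa x (n + 1) = aa x n - bb x n := by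
  unfold aa bb
  have h := lg_rec ((n : ℝ) + 1 / 2) x (by positivity) hx
  have e : ((n + 1 : ℕ) : ℝ) + 1 / 2 = (n : ℝ) + 3 / 2 := by push_cast; ring
  have e' : (n : ℝ) + 1 / 2 + 1 = (n : ℝ) + 3 / 2 := by ring
  rw [e'] at h
  rw [e, h, gam_rec, rp x hx]
  have : 0 < Real.Gamma ((n : ℝ) + 1 / 2) := Real.Gamma_pos_of_pos (by positivity)
  field_simp

lemma aa_nonneg (x : ℝ) (hx : 0 ≤ x) (n : ℕ) : 0 ≤ aa x n :=
  div_nonneg (lg_nonneg _ _ hx) (Real.Gamma_pos_of_pos (by positivity)).le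

lemma bb_nonneg (x : ℝ) (hx : 0 ≤ x) (n : ℕ) : 0 ≤ bb x n := by
  have : 0 < Real.Gamma ((n : ℝ) + 3 / 2) := Real.Gamma_pos_of_pos (by positivity)
  unfold bb
  positivity

lemma aa_le (x : ℝ) (hx : 0 ≤ x) (n : ℕ) : aa x n ≤ aa x 0 := by
  induction n with
  | zero => exact le_rfl
  | succ n ih => rw [aa_succ x hx]; linarith [bb_nonneg x hx n]

lemma bb_sum (x : ℝ) (hx : 0 ≤ x) : Summable (bb x) := by
  apply summable_of_sum_range_le (c := aa x 0) (bb_nonneg x hx)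
  intro n
  have : ∑ i ∈ Finset.range n, bb x i = aa x 0 - aa x n := by
    induction n with
    | zero => simp
    | succ n ih => rw [Finset.sum_range_succ, ih, aa_succ x hx]; ring
  linarith [aa_nonneg x hx n]

lemma bb_hasSum (x : ℝ) (hx : 0 ≤ x) : HasSum (bb x) (aa x 0) := by
  have hs : ∀ n, ∑ i ∈ Finset.range n, bb x i = aa x 0 - aa x n := by
    intro n
    induction n with
    | zero => simp
    | succ n ih => rw [Finset.sum_range_succ, ih, aa_succ x hx]; ring
  have hle : ∀ n, aa x n ≤ Real.exp x * bb x n := by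
    intro n
    have h := lg_le ((n : ℝ) + 1 / 2) x (by positivity) hx
    have hg : 0 < Real.Gamma ((n : ℝ) + 1 / 2) := Real.Gamma_pos_of_pos (by positivity)
    have : Real.exp x * bb x n =
        x ^ ((n : ℝ) + 1 / 2) / ((n : ℝ) + 1 / 2) / Real.Gamma ((n : ℝ) + 1 / 2) := by
      unfold bb
      rw [gam_rec, rp x hx, Real.exp_neg]
      have := Real.exp_pos x
      field_simp
    rw [this]
    unfold aa
    gcongr
  have h0 : Filter.Tendsto (aa x) Filter.atTop (nhds 0) := by
    have := ((bb_sum x hx).tendsto_atTop_zero).const_mul (Real.exp x)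
    rw [mul_zero] at this
    exact squeeze_zero (aa_nonneg x hx) hle this
  rw [(bb_sum x hx).hasSum_iff_tendsto_nat]
  simp_rw [hs]
  simpa using h0.const_sub (aa x 0)

lemma aa_zero (x : ℝ) (hx : 0 ≤ x) : aa x 0 = erf (Real.sqrt x) := by
  unfold aa
  have := Real.sqrt_pos.2 Real.pi_pos
  simp only [Nat.cast_zero, zero_add]
  rw [lg_half x hx, Real.Gamma_one_half_eq]
  field_simp

lemma erf_neg' (x : ℝ) : erf (-x) = - erf x := by
  unfold erf
  have := intervalIntegral.integral_comp_neg (a := 0) (b := x) (fun t : ℝ => Real.exp (-t ^ 2))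
  simp only [neg_sq, neg_zero] at this
  rw [this, intervalIntegral.integral_symm]
  ring

lemma abs_erf (x : ℝ) : |x| * erf |x| = x * erf x := by
  rcases abs_choice x with h | h <;> rw [h]
  rw [erf_neg']; ring

theorem monthly_10977 (β t : ℝ) (ht : 0 < t) :
    ∑' n : ℕ, (β ^ 2 / (1 + β ^ 2)) ^ n *
        lowerGamma ((n : ℝ) + 1 / 2) ((1 + β ^ 2) * t) / Real.Gamma ((n : ℝ) + 1 / 2) =
      (1 + β ^ 2) * erf (Real.sqrt ((1 + β ^ 2) * t)) -
        Real.exp (-t) * β * Real.sqrt (1 + β ^ 2) * erf (β * Real.sqrt t) := by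
  have hc : 0 < 1 + β ^ 2 := by positivity
  have hx : 0 ≤ (1 + β ^ 2) * t := by positivity
  have hz : 0 ≤ β ^ 2 * t := by positivity
  have hr0 : 0 ≤ β ^ 2 / (1 + β ^ 2) := by positivity
  have hr1 : β ^ 2 / (1 + β ^ 2) < 1 := by rw [div_lt_one hc]; linarith
  have hrx : β ^ 2 / (1 + β ^ 2) * ((1 + β ^ 2) * t) = β ^ 2 * t := by field_simp
  have hsx : Real.sqrt ((1 + β ^ 2) * t) = Real.sqrt (1 + β ^ 2) * Real.sqrt t :=
    Real.sqrt_mul hc.le t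
  have hsz : Real.sqrt (β ^ 2 * t) = |β * Real.sqrt t| := by
    rw [Real.sqrt_mul (sq_nonneg β), Real.sqrt_sq_eq_abs, abs_mul, abs_of_nonneg (Real.sqrt_nonneg t)]
  have hcr : (1 + β ^ 2) * (1 - β ^ 2 / (1 + β ^ 2)) = 1 := by field_simp; ring
  have hcr2 : (1 + β ^ 2) * (β ^ 2 / (1 + β ^ 2)) = β ^ 2 := by field_simp
  rw [← aa_zero _ hx]
  have hterm : ∀ n : ℕ, (β ^ 2 / (1 + β ^ 2)) ^ n *
        lowerGamma ((n : ℝ) + 1 / 2) ((1 + β ^ 2) * t) / Real.Gamma ((n : ℝ) + 1 / 2) =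
      (β ^ 2 / (1 + β ^ 2)) ^ n * aa ((1 + β ^ 2) * t) n := fun n => mul_div_assoc _ _ _
  simp_rw [hterm]
  generalize hr : β ^ 2 / (1 + β ^ 2) = r at *
  have hsum : Summable (fun n => r ^ n * aa ((1 + β ^ 2) * t) n) := by
    refine Summable.of_nonneg_of_le (fun n => mul_nonneg (pow_nonneg hr0 n) (aa_nonneg _ hx n))
      (fun n => ?_) ((summable_geometric_of_lt_one hr0 hr1).mul_right (aa ((1 + β ^ 2) * t) 0))
    exact mul_le_mul_of_nonneg_left (aa_le _ hx n) (pow_nonneg hr0 n)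
  have hb : Summable (fun n => r ^ n * bb ((1 + β ^ 2) * t) n) := by
    refine Summable.of_nonneg_of_le (fun n => mul_nonneg (pow_nonneg hr0 n) (bb_nonneg _ hx n))
      (fun n => ?_) (bb_sum _ hx)
    exact mul_le_of_le_one_left (bb_nonneg _ hx n) (pow_le_one₀ hr0 hr1.le)
  have hS := hsum.tsum_eq_zero_add
  have hstep : ∀ n, r ^ (n + 1) * aa ((1 + β ^ 2) * t) (n + 1) =
      r * (r ^ n * aa ((1 + β ^ 2) * t) n) - r * (r ^ n * bb ((1 + β ^ 2) * t) n) := by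
    intro n
    rw [aa_succ _ hx]; ring
  simp_rw [hstep] at hS
  rw [(hsum.mul_left r).tsum_sub (hb.mul_left r), tsum_mul_left, tsum_mul_left] at hS
  -- scaling of the b-series
  have hB : |β * Real.sqrt t| * (∑' n, r ^ n * bb ((1 + β ^ 2) * t) n) =
      Real.sqrt (1 + β ^ 2) * Real.sqrt t * Real.exp (-t) * erf |β * Real.sqrt t| := by
    rw [← hsz, ← aa_zero _ hz, ← (bb_hasSum _ hz).tsum_eq, ← tsum_mul_left, ← tsum_mul_left]
    congr 1
    ext n
    unfold bb
    rw [← hsx, ← hrx, mul_pow r, show -((1 + β ^ 2) * t) = -t + -(r * ((1 + β ^ 2) * t)) by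
      rw [hrx]; ring, Real.exp_add]
    ring
  generalize (∑' n, r ^ n * bb ((1 + β ^ 2) * t) n) = B at *
  generalize (∑' n, r ^ n * aa ((1 + β ^ 2) * t) n) = S at *
  have hst := Real.sqrt_pos.2 ht
  have hB2 : β ^ 2 * B = Real.exp (-t) * β * Real.sqrt (1 + β ^ 2) * erf (β * Real.sqrt t) := by
    have h1 : |β * Real.sqrt t| * (|β * Real.sqrt t| * B) =
        Real.sqrt (1 + β ^ 2) * Real.sqrt t * Real.exp (-t) *
          ((β * Real.sqrt t) * erf (β * Real.sqrt t)) := by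
      rw [hB, ← abs_erf]; ring
    rw [← mul_assoc, abs_mul_abs_self] at h1
    have h2 : Real.sqrt t ^ 2 ≠ 0 := by positivity
    apply mul_left_cancel₀ h2
    linear_combination h1
  rw [← hB2]
  simp only [pow_zero, one_mul] at hS
  linear_combination (1 + β ^ 2) * hS - S * hcr - B * hcr2
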